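/- The vector fields e₁(x,y,z) = (1, 0, 0), e₂(x,y,z) = (0, −x/√(1+x²), −√(1+x²)), e₃(x,y,z) = (0, 1/√(1+x²), 0) on ℝ³ satisfy the Lie bracket relations [e₁, e₂] = (x/(1+x²))·e₂ − ((1−x²)/(1+x²))·e₃, [e₁, e₃] = −(x/(1+x²))·e₃, and [e₂, e₃] = 0 at every point of ℝ³. In particular, in the notation of the integrability data of the associated Riemannian submersion from Nil space this gives κ₁ = −x/(1+x²) ≢ 0, κ₂ = 0, f₁ = 0, f₂ = x/(1+x²), σ = (1−x²)/(2(1+x²)). -/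

import Mathlib

noncomputable section

/-- `e₁ = ∂/∂x`. -/
def nilE1 (p : Fin 3 → ℝ) : Fin 3 → ℝ := ![1, 0, 0]

/-- `e₂ = −(x/√(1+x²)) ∂/∂y − √(1+x²) ∂/∂z`. -/
def nilE2 (p : Fin 3 → ℝ) : Fin 3 → ℝ :=
  ![0, -(p 0) / Real.sqrt (1 + (p 0) ^ 2), -Real.sqrt (1 + (p 0) ^ 2)]

/-- `e₃ = (1/√(1+x²)) ∂/∂y`. -/
def nilE3 (p : Fin 3 → ℝ) : Fin 3 → ℝ :=
  ![0, 1 / Real.sqrt (1 + (p 0) ^ 2), 0]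

/-- Lie bracket of vector fields on `ℝ³`:
`[X,Y](p) = DY(p)(X(p)) − DX(p)(Y(p))`. -/
def lieBracket (X Y : (Fin 3 → ℝ) → (Fin 3 → ℝ)) (p : Fin 3 → ℝ) : Fin 3 → ℝ :=
  fderiv ℝ Y p (X p) - fderiv ℝ X p (Y p)

theorem fderiv_aux (g : ℝ → Fin 3 → ℝ) (g' : Fin 3 → ℝ) (p v : Fin 3 → ℝ)
    (h : HasDerivAt g g' (p 0)) :
    fderiv ℝ (fun q : Fin 3 → ℝ => g (q 0)) p v = v 0 • g' := by
  have h1 : HasFDerivAt (fun q : Fin 3 → ℝ => q 0)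
      (ContinuousLinearMap.proj (R := ℝ) (φ := fun _ : Fin 3 => ℝ) 0) p :=
    (ContinuousLinearMap.proj (R := ℝ) (φ := fun _ : Fin 3 => ℝ) 0).hasFDerivAt
  have h2 := HasFDerivAt.comp (f := fun q : Fin 3 → ℝ => q 0) p h.hasFDerivAt h1
  have h3 : fderiv ℝ (fun q : Fin 3 → ℝ => g (q 0)) p = _ := h2.fderiv
  rw [h3]
  simp

theorem sqrt_aux (x : ℝ) :
    HasDerivAt (fun x : ℝ => Real.sqrt (1 + x ^ 2)) (x / Real.sqrt (1 + x ^ 2)) x := by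
  have h : HasDerivAt (fun x : ℝ => 1 + x ^ 2) (2 * x) x := by
    simpa using (hasDerivAt_pow 2 x).const_add 1
  have := h.sqrt (by positivity)
  convert this using 1
  field_simp

theorem fderiv_E1 (p v : Fin 3 → ℝ) : fderiv ℝ nilE1 p v = 0 := by
  have : nilE1 = fun _ => ![1, 0, 0] := rfl
  rw [this]
  simp

theorem fderiv_E2 (p v : Fin 3 → ℝ) : fderiv ℝ nilE2 p v =
    v 0 • ![0, -1 / Real.sqrt (1 + (p 0) ^ 2) ^ 3, -(p 0 / Real.sqrt (1 + (p 0) ^ 2))] := by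
  refine fderiv_aux (fun x => ![0, -x / Real.sqrt (1 + x ^ 2), -Real.sqrt (1 + x ^ 2)]) _ p v ?_
  generalize p 0 = x
  have hs : 0 < Real.sqrt (1 + x ^ 2) := by positivity
  have hq : Real.sqrt (1 + x ^ 2) ^ 2 = 1 + x ^ 2 := Real.sq_sqrt (by positivity)
  rw [hasDerivAt_pi]
  intro i
  fin_cases i
  · exact hasDerivAt_const x 0
  · have := (hasDerivAt_id x).neg.div (sqrt_aux x) hs.ne'
    refine this.congr_deriv ?_
    simp
    generalize Real.sqrt (1 + x ^ 2) = s at *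
    field_simp
    linarith
  · exact (sqrt_aux x).neg

theorem fderiv_E3 (p v : Fin 3 → ℝ) : fderiv ℝ nilE3 p v =
    v 0 • ![0, -(p 0) / Real.sqrt (1 + (p 0) ^ 2) ^ 3, 0] := by
  refine fderiv_aux (fun x => ![0, 1 / Real.sqrt (1 + x ^ 2), 0]) _ p v ?_
  generalize p 0 = x
  have hs : 0 < Real.sqrt (1 + x ^ 2) := by positivity
  rw [hasDerivAt_pi]
  intro i
  fin_cases i
  · exact hasDerivAt_const x 0
  · have := (hasDerivAt_const x (1:ℝ)).div (sqrt_aux x) hs.ne'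
    refine this.congr_deriv ?_
    simp
    generalize Real.sqrt (1 + x ^ 2) = s at *
    field_simp
  · exact hasDerivAt_const x 0

theorem nilFrame_lieBrackets :
    (∀ p : Fin 3 → ℝ,
      lieBracket nilE1 nilE2 p =
        (p 0 / (1 + (p 0) ^ 2)) • nilE2 p -
          ((1 - (p 0) ^ 2) / (1 + (p 0) ^ 2)) • nilE3 p) ∧
    (∀ p : Fin 3 → ℝ,
      lieBracket nilE1 nilE3 p = (-(p 0 / (1 + (p 0) ^ 2))) • nilE3 p) ∧
    (∀ p : Fin 3 → ℝ, lieBracket nilE2 nilE3 p = 0) ∧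
    -- in particular, the integrability datum κ₁ = −x/(1+x²) does not vanish identically
    (∃ p : Fin 3 → ℝ, -(p 0 / (1 + (p 0) ^ 2)) ≠ 0) := by
  refine ⟨fun p => ?_, fun p => ?_, fun p => ?_, ⟨fun _ => 1, by norm_num⟩⟩
  · have hs : 0 < Real.sqrt (1 + (p 0) ^ 2) := by positivity
    have hq : 1 + (p 0) ^ 2 = Real.sqrt (1 + (p 0) ^ 2) ^ 2 :=
      (Real.sq_sqrt (by positivity)).symm
    rw [lieBracket, fderiv_E1, fderiv_E2]
    simp only [nilE1, nilE2, nilE3]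
    generalize Real.sqrt (1 + (p 0) ^ 2) = s at *
    rw [hq]
    ext i
    fin_cases i
    · simp
    · simp
      field_simp
      ring
    · simp
      field_simp
  · have hs : 0 < Real.sqrt (1 + (p 0) ^ 2) := by positivity
    have hq : 1 + (p 0) ^ 2 = Real.sqrt (1 + (p 0) ^ 2) ^ 2 :=
      (Real.sq_sqrt (by positivity)).symm
    rw [lieBracket, fderiv_E1, fderiv_E3]
    simp only [nilE1, nilE3]
    generalize Real.sqrt (1 + (p 0) ^ 2) = s at *
    rw [hq]
    ext i
    fin_cases i
    · simp
    · simp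
      field_simp
    · simp
  · rw [lieBracket, fderiv_E2, fderiv_E3]
    simp [nilE2, nilE3]
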